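/- Let U ⊆ ℂ^m be open and let h be a hermitian metric on the trivial bundle U×ℂ^N with curvature Θ_{jk}. Then the following are equivalent: (i) h is Griffiths-seminegative, i.e. Σ_{j,k=1}^m ⟪h(t)·Θ_{jk}(t)·a, a⟫·v_j·conj(v_k) ≤ 0 for every t ∈ U, every a ∈ ℂ^N and every v ∈ ℂ^m; (ii) for every open subset V ⊆ U and every nowhere-vanishing holomorphic map u : V → ℂ^N, the smooth function t ↦ log ⟪h(t)·u(t), u(t)⟫ is plurisubharmonic on V. (The characterization of Griffiths negativity by plurisubharmonicity of log‖u‖² for nonvanishing local holomorphic sections, Section 2.) -/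

import Mathlib

open Complex Matrix
open scoped ComplexOrder

noncomputable section

/-- The Wirtinger derivative `∂_w f (x)` in the direction `w`,
defined via the real Fréchet derivative. -/
def wD {E : Type*} [NormedAddCommGroup E] [NormedSpace ℂ E] (f : E → ℂ) (x w : E) : ℂ :=
  (fderiv ℝ f x w - Complex.I * fderiv ℝ f x (Complex.I • w)) / 2

/-- The Wirtinger derivative `∂̄_w f (x)` in the direction `w`. -/
def wDbar {E : Type*} [NormedAddCommGroup E] [NormedSpace ℂ E] (f : E → ℂ) (x w : E) : ℂ :=
  (fderiv ℝ f x w + Complex.I * fderiv ℝ f x (Complex.I • w)) / 2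

/-- The standard inner product `⟪x,y⟫ = Σ_i x_i·conj(y_i)` on `ℂ^N`. -/
def sip {N : ℕ} (x y : Fin N → ℂ) : ℂ := ∑ i, x i * (starRingEnd ℂ) (y i)

/-- Entrywise Wirtinger `∂_j` of a matrix-valued function. -/
def mD {m N : ℕ} (f : (Fin m → ℂ) → Matrix (Fin N) (Fin N) ℂ) (x : Fin m → ℂ) (j : Fin m) :
    Matrix (Fin N) (Fin N) ℂ :=
  Matrix.of fun a b => wD (fun s => f s a b) x (Pi.single j 1)

/-- Entrywise Wirtinger `∂̄_k` of a matrix-valued function. -/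
def mDbar {m N : ℕ} (f : (Fin m → ℂ) → Matrix (Fin N) (Fin N) ℂ) (x : Fin m → ℂ) (k : Fin m) :
    Matrix (Fin N) (Fin N) ℂ :=
  Matrix.of fun a b => wDbar (fun s => f s a b) x (Pi.single k 1)

/-- Entrywise Wirtinger `∂_j` of a vector-valued function. -/
def vD {m N : ℕ} (f : (Fin m → ℂ) → (Fin N → ℂ)) (x : Fin m → ℂ) (j : Fin m) : Fin N → ℂ :=
  fun a => wD (fun s => f s a) x (Pi.single j 1)

/-- Entrywise Wirtinger `∂̄_k` of a vector-valued function. -/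
def vDbar {m N : ℕ} (f : (Fin m → ℂ) → (Fin N → ℂ)) (x : Fin m → ℂ) (k : Fin m) : Fin N → ℂ :=
  fun a => wDbar (fun s => f s a) x (Pi.single k 1)

/-- The Chern connection `D_j u = ∂_j u + h⁻¹(∂_j h)·u` of the hermitian metric `h`. -/
def chern {m N : ℕ} (h : (Fin m → ℂ) → Matrix (Fin N) (Fin N) ℂ)
    (u : (Fin m → ℂ) → (Fin N → ℂ)) (j : Fin m) (t : Fin m → ℂ) : Fin N → ℂ :=
  vD u t j + ((h t)⁻¹ * mD h t j) *ᵥ u t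

/-- The curvature `Θ_{jk} = −∂̄_k(h⁻¹·∂_j h)` of the hermitian metric `h`. -/
def curv {m N : ℕ} (h : (Fin m → ℂ) → Matrix (Fin N) (Fin N) ℂ)
    (j k : Fin m) (t : Fin m → ℂ) : Matrix (Fin N) (Fin N) ℂ :=
  - mDbar (fun s => (h s)⁻¹ * mD h s j) t k

/-- `f` is real-differentiable at `x`, with Wirtinger derivatives `∂_w f = a` and `∂̄_w f = b`. -/
def HasWirtinger {E : Type*} [NormedAddCommGroup E] [NormedSpace ℂ E]
    (f : E → ℂ) (x w : E) (a b : ℂ) : Prop :=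
  DifferentiableAt ℝ f x ∧ wD f x w = a ∧ wDbar f x w = b

section Wirtinger

variable {E : Type*} [NormedAddCommGroup E] [NormedSpace ℂ E] {f g : E → ℂ} {x w : E}
  {a b c d : ℂ}

theorem DifferentiableAt.hasWirtinger (hf : DifferentiableAt ℝ f x) (w : E) :
    HasWirtinger f x w (wD f x w) (wDbar f x w) :=
  ⟨hf, rfl, rfl⟩

theorem HasFDerivAt.hasWirtinger {L : E →L[ℝ] ℂ} (hf : HasFDerivAt f L x) (w : E) :
    HasWirtinger f x w ((L w - I * L (I • w)) / 2) ((L w + I * L (I • w)) / 2) := by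
  refine ⟨hf.differentiableAt, ?_, ?_⟩ <;> simp [wD, wDbar, hf.fderiv]

theorem HasWirtinger.congr (hf : HasWirtinger f x w a b) (ha : a = c) (hb : b = d) :
    HasWirtinger f x w c d := by
  subst ha hb; exact hf

theorem HasWirtinger.congr_of_eventuallyEq (hf : HasWirtinger f x w a b)
    (h : g =ᶠ[nhds x] f) : HasWirtinger g x w a b := by
  obtain ⟨hd, rfl, rfl⟩ := hf
  refine ⟨hd.congr_of_eventuallyEq h, ?_, ?_⟩ <;> simp [wD, wDbar, h.fderiv_eq]

theorem HasWirtinger.mul (hf : HasWirtinger f x w a b) (hg : HasWirtinger g x w c d) :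
    HasWirtinger (fun y => f y * g y) x w (a * g x + f x * c) (b * g x + f x * d) := by
  obtain ⟨hd, rfl, rfl⟩ := hf
  obtain ⟨hd', rfl, rfl⟩ := hg
  refine ((hd.hasFDerivAt.mul hd'.hasFDerivAt).hasWirtinger w).congr ?_ ?_ <;>
  · simp [wD, wDbar]
    ring

theorem HasWirtinger.add (hf : HasWirtinger f x w a b) (hg : HasWirtinger g x w c d) :
    HasWirtinger (fun y => f y + g y) x w (a + c) (b + d) := by
  obtain ⟨hd, rfl, rfl⟩ := hf
  obtain ⟨hd', rfl, rfl⟩ := hg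
  refine ((hd.hasFDerivAt.add hd'.hasFDerivAt).hasWirtinger w).congr ?_ ?_ <;>
  · simp [wD, wDbar]
    ring

theorem hasWirtinger_const (c : ℂ) : HasWirtinger (fun _ : E => c) x w 0 0 :=
  ((hasFDerivAt_const c x).hasWirtinger w).congr (by simp) (by simp)

theorem HasWirtinger.sum {ι : Type*} (s : Finset ι) {f : ι → E → ℂ} {a b : ι → ℂ}
    (hf : ∀ i ∈ s, HasWirtinger (f i) x w (a i) (b i)) :
    HasWirtinger (fun y => ∑ i ∈ s, f i y) x w (∑ i ∈ s, a i) (∑ i ∈ s, b i) := by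
  classical
  induction s using Finset.induction_on with
  | empty => simpa using hasWirtinger_const 0
  | insert i s hi ih =>
    simp only [Finset.sum_insert hi]
    exact (hf i (by simp)).add (ih fun j hj => hf j (by simp [hj]))

theorem HasWirtinger.conj (hf : HasWirtinger f x w a b) :
    HasWirtinger (fun y => (starRingEnd ℂ) (f y)) x w
      ((starRingEnd ℂ) b) ((starRingEnd ℂ) a) := by
  obtain ⟨hd, rfl, rfl⟩ := hf
  refine (((conjCLE : ℂ →L[ℝ] ℂ).hasFDerivAt.comp x hd.hasFDerivAt).hasWirtinger w).congr ?_ ?_ <;>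
  · simp [wD, wDbar, map_ofNat (starRingEnd ℂ) 2]
    try ring

theorem HasWirtinger.comp_hasDerivAt {φ : ℂ → ℂ} {φ' : ℂ} (hf : HasWirtinger f x w a b)
    (hφ : HasDerivAt φ φ' (f x)) :
    HasWirtinger (fun y => φ (f y)) x w (φ' * a) (φ' * b) := by
  obtain ⟨hd, rfl, rfl⟩ := hf
  refine (((hφ.hasFDerivAt.restrictScalars ℝ).comp x hd.hasFDerivAt).hasWirtinger w).congr ?_ ?_ <;>
  · simp [wD, wDbar]
    ring

theorem HasFDerivAt.hasWirtinger_of_complex {L : E →L[ℂ] ℂ} (hf : HasFDerivAt f L x) (w : E) :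
    HasWirtinger f x w (L w) 0 := by
  refine ((hf.restrictScalars ℝ).hasWirtinger w).congr ?_ ?_
  · simp only [ContinuousLinearMap.coe_restrictScalars', map_smul, smul_eq_mul]
    linear_combination (-(L w) / 2) * I_mul_I
  · simp only [ContinuousLinearMap.coe_restrictScalars', map_smul, smul_eq_mul]
    linear_combination ((L w) / 2) * I_mul_I

theorem wD_eq_sum {m : ℕ} (f : (Fin m → ℂ) → ℂ) (x w : Fin m → ℂ) :
    wD f x w = ∑ j, w j * wD f x (Pi.single j 1) := by
  let L : (Fin m → ℂ) →ₗ[ℂ] ℂ :=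
    { toFun := fun v => wD f x v
      map_add' := fun v v' => by simp only [wD, smul_add, map_add]; ring
      map_smul' := fun c v => by
        have h1 : c • v = c.re • v + c.im • (I • v) := by
          ext i
          simp only [Pi.smul_apply, Pi.add_apply, smul_eq_mul, real_smul]
          conv_lhs => rw [← re_add_im c]
          ring
        have h2 : I • c • v = c.re • (I • v) - c.im • v := by
          ext i
          simp only [Pi.smul_apply, Pi.sub_apply, smul_eq_mul, real_smul]
          conv_lhs => rw [← re_add_im c]
          linear_combination (c.im * v i) * I_mul_I
        simp only [wD, h2]
        simp only [h1, map_add, map_sub, map_smul, real_smul, RingHom.id_apply, smul_eq_mul]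
        conv_rhs => rw [← re_add_im c]
        linear_combination ((c.im : ℂ) * fderiv ℝ f x (I • v) / 2) * I_mul_I }
  refine (LinearMap.pi_apply_eq_sum_univ L w).trans (Finset.sum_congr rfl fun j _ => ?_)
  have hj : (fun i => if j = i then (1 : ℂ) else 0) = Pi.single j 1 := by
    ext i
    simp [Pi.single_apply, eq_comm]
  rw [hj, smul_eq_mul]
  rfl

theorem wDbar_eq_sum {m : ℕ} {f : (Fin m → ℂ) → ℂ} {x : Fin m → ℂ} (hf : DifferentiableAt ℝ f x)
    (w : Fin m → ℂ) :
    wDbar f x w = ∑ k, (starRingEnd ℂ) (w k) * wDbar f x (Pi.single k 1) := by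
  have key : ∀ v, wDbar f x v = (starRingEnd ℂ) (wD (fun y => (starRingEnd ℂ) (f y)) x v) := by
    intro v
    rw [(hf.hasWirtinger v).conj.2.1, conj_conj]
  rw [key, wD_eq_sum]
  simp only [map_sum, map_mul, key]

theorem differentiableAt_fderiv_apply (hf : ContDiffAt ℝ 2 f x) (v : E) :
    DifferentiableAt ℝ (fun y => fderiv ℝ f y v) x :=
  ((hf.fderiv_right (m := 1) (by norm_num)).differentiableAt (by norm_num)).clm_apply
    (differentiableAt_const v)

theorem differentiableAt_wD (hf : ContDiffAt ℝ 2 f x) (w : E) :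
    DifferentiableAt ℝ (fun y => wD f y w) x := by
  have h1 := differentiableAt_fderiv_apply hf w
  have h2 := differentiableAt_fderiv_apply hf (I • w)
  unfold wD
  fun_prop

theorem differentiableAt_wDbar (hf : ContDiffAt ℝ 2 f x) (w : E) :
    DifferentiableAt ℝ (fun y => wDbar f y w) x := by
  have h1 := differentiableAt_fderiv_apply hf w
  have h2 := differentiableAt_fderiv_apply hf (I • w)
  unfold wDbar
  fun_prop

theorem wDbar_wD_comm (hf : ContDiffAt ℝ 2 f x) (w : E) :
    wDbar (fun y => wD f y w) x w = wD (fun y => wDbar f y w) x w := by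
  have hd : DifferentiableAt ℝ (fderiv ℝ f) x :=
    (hf.fderiv_right (m := 1) (by norm_num)).differentiableAt (by norm_num)
  have key : ∀ v, HasFDerivAt (fun y => fderiv ℝ f y v)
      ((fderiv ℝ (fderiv ℝ f) x).flip v) x := fun v => by
    have := hd.hasFDerivAt.clm_apply (hasFDerivAt_const v x)
    simpa using this
  have hs := hf.isSymmSndFDerivAt (by simp) w (I • w)
  have e1 : ∀ v, HasWirtinger (fun y => fderiv ℝ f y v) x w _ _ := fun v => (key v).hasWirtinger w
  have hD := ((e1 w).add ((hasWirtinger_const (-I)).mul (e1 (I • w)))).mul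
    (hasWirtinger_const (1 / 2))
  have hDb := ((e1 w).add ((hasWirtinger_const I).mul (e1 (I • w)))).mul
    (hasWirtinger_const (1 / 2))
  have f1 : (fun y => wD f y w) =
      fun y => (fderiv ℝ f y w + -I * fderiv ℝ f y (I • w)) * (1 / 2) := by
    funext y; simp only [wD]; ring
  have f2 : (fun y => wDbar f y w) =
      fun y => (fderiv ℝ f y w + I * fderiv ℝ f y (I • w)) * (1 / 2) := by
    funext y; simp only [wDbar]; ring
  rw [f1, f2, hD.2.2, hDb.2.1]
  simp only [ContinuousLinearMap.flip_apply, hs]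
  ring

end Wirtinger

theorem DifferentiableOn.exists_lipschitzOnWith_ball {E : Type*} [NormedAddCommGroup E]
    [NormedSpace ℂ E] {f : E → ℂ} {V : Set E} (hf : DifferentiableOn ℂ f V) (hV : IsOpen V)
    {p : E} (hp : p ∈ V) :
    ∃ δ > 0, Metric.ball p δ ⊆ V ∧ ∃ C, LipschitzOnWith C f (Metric.ball p δ) := by
  obtain ⟨δ₁, hδ₁, hVδ⟩ := Metric.isOpen_iff.1 hV p hp
  have hc : ContinuousAt f p := (hf.differentiableAt (hV.mem_nhds hp)).continuousAt
  obtain ⟨δ₂, hδ₂, hfδ⟩ := Metric.continuousAt_iff.1 hc 1 one_pos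
  set δ := min δ₁ δ₂
  have hδ0 : 0 < δ := lt_min hδ₁ hδ₂
  have hsub : ∀ x ∈ Metric.ball p (δ / 2), Metric.ball x (δ / 2) ⊆ Metric.ball p δ := by
    intro x hx y hy
    rw [Metric.mem_ball] at *
    linarith [dist_triangle y x p]
  have hbV : Metric.ball p δ ⊆ V := (Metric.ball_subset_ball (min_le_left _ _)).trans hVδ
  refine ⟨δ / 2, by positivity, (Metric.ball_subset_ball (by linarith)).trans hbV,
    Real.toNNReal (2 / (δ / 2)), ?_⟩
  refine Convex.lipschitzOnWith_of_nnnorm_fderiv_le (𝕜 := ℂ) (fun x hx => ?_) (fun x hx => ?_)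
    (convex_ball p _)
  · exact hf.differentiableAt
      (hV.mem_nhds (hbV (Metric.ball_subset_ball (by linarith) hx)))
  · rw [← NNReal.coe_le_coe, coe_nnnorm, Real.coe_toNNReal _ (by positivity)]
    refine norm_fderiv_le_div_of_mapsTo_ball (hf.mono ((hsub x hx).trans hbV))
      (fun y hy => ?_) (by positivity)
    have h1 := hfδ (lt_of_lt_of_le (hsub x hx hy) (min_le_right _ _))
    have h2 := hfδ (lt_of_lt_of_le
      (Metric.ball_subset_ball (by linarith : δ / 2 ≤ δ) hx) (min_le_right _ _))
    rw [Metric.mem_closedBall]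
    linarith [dist_triangle_right (f y) (f x) (f p)]

/-- Directional derivatives of a holomorphic function of several variables are holomorphic. -/
theorem differentiableOn_fderiv_apply {m : ℕ} {f : (Fin m → ℂ) → ℂ} {V : Set (Fin m → ℂ)}
    (hf : DifferentiableOn ℂ f V) (hV : IsOpen V) (w : Fin m → ℂ) :
    DifferentiableOn ℂ (fun x => fderiv ℂ f x w) V := by
  intro p hp
  refine DifferentiableAt.differentiableWithinAt ?_
  obtain ⟨δ, hδ, hbV, C, hC⟩ := hf.exists_lipschitzOnWith_ball hV hp
  obtain ⟨r, hr, hrw⟩ : ∃ r > 0, r * ‖w‖ < δ / 2 := by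
    refine ⟨δ / 2 / (‖w‖ + 1), by positivity, ?_⟩
    rw [div_mul_eq_mul_div, div_lt_iff₀ (by positivity)]
    nlinarith [norm_nonneg w]
  have hmem : ∀ x ∈ Metric.ball p (δ / 2), ∀ z ∈ Metric.closedBall (0 : ℂ) r,
      x + z • w ∈ Metric.ball p δ := by
    intro x hx z hz
    rw [mem_ball_iff_norm] at *
    rw [mem_closedBall_zero_iff] at hz
    have : ‖z • w‖ ≤ r * ‖w‖ := by rw [norm_smul]; gcongr
    calc ‖x + z • w - p‖ = ‖(x - p) + z • w‖ := by congr 1; abel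
      _ ≤ ‖x - p‖ + ‖z • w‖ := norm_add_le _ _
      _ < δ := by linarith
  have hcirc : ∀ θ : ℝ, circleMap 0 r θ ∈ Metric.closedBall (0 : ℂ) r := fun θ =>
    circleMap_mem_closedBall 0 hr.le θ
  have hdf : ∀ x ∈ Metric.ball p δ, HasFDerivAt f (fderiv ℂ f x) x := fun x hx =>
    (hf.differentiableAt (hV.mem_nhds (hbV hx))).hasFDerivAt
  have hline : ∀ x, ∀ z : ℂ, HasDerivAt (fun z : ℂ => x + z • w) w z := fun x z => by
    simpa using ((hasDerivAt_id z).smul_const w).const_add x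
  have hcauchy : ∀ x ∈ Metric.ball p (δ / 2),
      fderiv ℂ f x w = (2 * Real.pi * I : ℂ)⁻¹ • ∫ θ in (0 : ℝ)..2 * Real.pi,
        (deriv (circleMap 0 r) θ * ((circleMap 0 r θ) ^ 2)⁻¹) •
          f (x + circleMap 0 r θ • w) := by
    intro x hx
    have hU : IsOpen ((fun z : ℂ => x + z • w) ⁻¹' Metric.ball p δ) :=
      Metric.isOpen_ball.preimage (by fun_prop)
    have hg : DifferentiableOn ℂ (fun z : ℂ => f (x + z • w))
        ((fun z : ℂ => x + z • w) ⁻¹' Metric.ball p δ) := fun z hz =>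
      ((hdf _ hz).comp_hasDerivAt z (hline x z)).differentiableAt.differentiableWithinAt
    have h1 := two_pi_I_inv_smul_circleIntegral_sub_sq_inv_smul_of_differentiable hU
      (fun z hz => hmem x hx z hz) hg (Metric.mem_ball_self hr)
    have h2 : deriv (fun z : ℂ => f (x + z • w)) 0 = fderiv ℂ f x w := by
      have hx0 : x + (0 : ℂ) • w ∈ Metric.ball p δ :=
        hmem x hx 0 (by simp [hr.le])
      have := ((hdf _ hx0).comp_hasDerivAt (0 : ℂ) (hline x 0)).deriv
      simpa [Function.comp_def] using this
    rw [← h2, ← h1]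
    simp only [circleIntegral, sub_zero, smul_eq_mul, mul_assoc]
  set κ : ℝ → ℂ := fun θ => deriv (circleMap 0 r) θ * ((circleMap 0 r θ) ^ 2)⁻¹
  have hκc : Continuous κ := by
    refine Continuous.mul ?_ (Continuous.inv₀ (by fun_prop) fun θ => ?_)
    · have hd : deriv (circleMap 0 r) = fun θ => circleMap 0 r θ * I := by
        ext θ
        simp
      rw [hd]
      fun_prop
    · exact pow_ne_zero 2 (circleMap_ne_center hr.ne')
  have hFc : ∀ x ∈ Metric.ball p (δ / 2),
      Continuous (fun θ : ℝ => κ θ • f (x + circleMap 0 r θ • w)) := by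
    intro x hx
    refine hκc.smul ?_
    exact hC.continuousOn.comp_continuous (by fun_prop) fun θ => hmem x hx _ (hcirc θ)
  have hp' : p ∈ Metric.ball p (δ / 2) := Metric.mem_ball_self (by positivity)
  have hnhds : Metric.ball p (δ / 2) ∈ nhds p := Metric.ball_mem_nhds p (by positivity)
  have hmain := intervalIntegral.hasFDerivAt_integral_of_dominated_loc_of_lip (𝕜 := ℂ)
    (μ := MeasureTheory.volume) (a := 0) (b := 2 * Real.pi)
    (F := fun x θ => κ θ • f (x + circleMap 0 r θ • w))
    (F' := fun θ => κ θ • fderiv ℂ f (p + circleMap 0 r θ • w)) (x₀ := p)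
    (bound := fun θ => ‖κ θ‖ * C) hnhds
    (Filter.eventually_of_mem hnhds fun x hx => (hFc x hx).aestronglyMeasurable)
    ((hFc p hp').intervalIntegrable _ _)
    ?_ ?_ ((hκc.norm.mul continuous_const).intervalIntegrable _ _) ?_
  · refine (hmain.2.differentiableAt.const_smul ((2 * Real.pi * I : ℂ)⁻¹)).congr_of_eventuallyEq ?_
    filter_upwards [hnhds] with x hx
    exact hcauchy x hx
  · refine Measurable.aestronglyMeasurable ?_
    refine hκc.measurable.smul ((measurable_fderiv ℂ f).comp ?_)
    exact Continuous.measurable (by fun_prop)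
  · refine Filter.Eventually.of_forall fun θ _ => ?_
    refine LipschitzOnWith.of_dist_le_mul fun x hx y hy => ?_
    have := hC.dist_le_mul _ (hmem x hx _ (hcirc θ)) _ (hmem y hy _ (hcirc θ))
    rw [dist_add_right] at this
    rw [dist_smul₀, Real.coe_nnabs, abs_of_nonneg (by positivity), mul_assoc]
    gcongr
  · refine Filter.Eventually.of_forall fun θ _ => ?_
    have hq := (hdf _ (hmem p hp' _ (hcirc θ))).comp p
      ((hasFDerivAt_id p).add_const (circleMap 0 r θ • w))
    exact hq.const_smul (κ θ)

theorem Complex.mul_nonneg_iff_of_pos {c z : ℂ} (hc : 0 < c) : 0 ≤ c * z ↔ 0 ≤ z := by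
  obtain ⟨hr, hi⟩ := Complex.pos_iff.1 hc
  simp [Complex.nonneg_iff, ← hi, hr, hr.ne', eq_comm]

section SesquilinearForm

variable {N : ℕ}

theorem sip_eq_dotProduct (x y : Fin N → ℂ) : sip x y = star y ⬝ᵥ x := by
  simp only [sip, dotProduct, Pi.star_apply, RCLike.star_def]
  exact Finset.sum_congr rfl fun i _ => mul_comm _ _

theorem sip_add_left (x x' y : Fin N → ℂ) : sip (x + x') y = sip x y + sip x' y := by
  simp [sip_eq_dotProduct]

theorem sip_sub_left (x x' y : Fin N → ℂ) : sip (x - x') y = sip x y - sip x' y := by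
  simp [sip_eq_dotProduct]

theorem sip_smul_left (c : ℂ) (x y : Fin N → ℂ) : sip (c • x) y = c * sip x y := by
  simp [sip_eq_dotProduct]

theorem sip_add_right (x y y' : Fin N → ℂ) : sip x (y + y') = sip x y + sip x y' := by
  simp [sip_eq_dotProduct]

theorem sip_sub_right (x y y' : Fin N → ℂ) : sip x (y - y') = sip x y - sip x y' := by
  simp [sip_eq_dotProduct]

theorem sip_smul_right (c : ℂ) (x y : Fin N → ℂ) :
    sip x (c • y) = (starRingEnd ℂ) c * sip x y := by
  simp [sip_eq_dotProduct]

theorem conj_sip (x y : Fin N → ℂ) : (starRingEnd ℂ) (sip x y) = sip y x := by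
  simp [sip, mul_comm]

theorem sip_conjTranspose_mulVec (A : Matrix (Fin N) (Fin N) ℂ) (x y : Fin N → ℂ) :
    sip (Aᴴ *ᵥ x) y = sip x (A *ᵥ y) := by
  rw [sip_eq_dotProduct, sip_eq_dotProduct, star_mulVec, dotProduct_mulVec]

theorem Matrix.PosDef.sip_pos {A : Matrix (Fin N) (Fin N) ℂ} (hA : A.PosDef) {x : Fin N → ℂ}
    (hx : x ≠ 0) : 0 < sip (A *ᵥ x) x := by
  rw [sip_eq_dotProduct]
  exact hA.dotProduct_mulVec_pos hx

theorem Matrix.PosDef.sip_nonneg {A : Matrix (Fin N) (Fin N) ℂ} (hA : A.PosDef)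
    (x : Fin N → ℂ) : 0 ≤ sip (A *ᵥ x) x := by
  rw [sip_eq_dotProduct]
  exact hA.posSemidef.dotProduct_mulVec_nonneg x

theorem Matrix.IsHermitian.conj_sip {A : Matrix (Fin N) (Fin N) ℂ} (hA : A.IsHermitian)
    (x y : Fin N → ℂ) : (starRingEnd ℂ) (sip (A *ᵥ x) y) = sip (A *ᵥ y) x := by
  rw [_root_.conj_sip, ← sip_conjTranspose_mulVec, hA.eq]

/-- The Cauchy–Schwarz inequality for the form `⟪A x, y⟫`. -/
theorem Matrix.PosDef.sip_mul_sip_le {A : Matrix (Fin N) (Fin N) ℂ} (hA : A.PosDef)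
    (x y : Fin N → ℂ) :
    sip (A *ᵥ x) y * sip (A *ᵥ y) x ≤ sip (A *ᵥ x) x * sip (A *ᵥ y) y := by
  rcases eq_or_ne x 0 with rfl | hx
  · simp [sip]
  have hF := hA.sip_pos hx
  have h1 := hA.isHermitian.conj_sip x x
  have h2 := hA.isHermitian.conj_sip y x
  have hz := hA.sip_nonneg (sip (A *ᵥ x) x • y - sip (A *ᵥ y) x • x)
  have he : sip (A *ᵥ (sip (A *ᵥ x) x • y - sip (A *ᵥ y) x • x))
      (sip (A *ᵥ x) x • y - sip (A *ᵥ y) x • x) =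
      sip (A *ᵥ x) x * (sip (A *ᵥ x) x * sip (A *ᵥ y) y - sip (A *ᵥ x) y * sip (A *ᵥ y) x) := by
    simp only [mulVec_sub, mulVec_smul, sip_sub_left, sip_sub_right, sip_smul_left,
      sip_smul_right, h1, h2]
    ring
  rw [he] at hz
  exact sub_nonneg.1 ((Complex.mul_nonneg_iff_of_pos hF).1 hz)

end SesquilinearForm

section MatrixWirtinger

variable {E : Type*} [NormedAddCommGroup E] [NormedSpace ℂ E] {N : ℕ} {x w : E}

theorem HasWirtinger.sip_mulVec {A : E → Matrix (Fin N) (Fin N) ℂ} {u v : E → Fin N → ℂ}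
    {A₁ A₂ : Matrix (Fin N) (Fin N) ℂ} {u₁ u₂ v₁ v₂ : Fin N → ℂ}
    (hA : ∀ i j, HasWirtinger (fun y => A y i j) x w (A₁ i j) (A₂ i j))
    (hu : ∀ i, HasWirtinger (fun y => u y i) x w (u₁ i) (u₂ i))
    (hv : ∀ i, HasWirtinger (fun y => v y i) x w (v₁ i) (v₂ i)) :
    HasWirtinger (fun y => sip (A y *ᵥ u y) (v y)) x w
      (sip (A₁ *ᵥ u x) (v x) + sip (A x *ᵥ u₁) (v x) + sip (A x *ᵥ u x) v₂)
      (sip (A₂ *ᵥ u x) (v x) + sip (A x *ᵥ u₂) (v x) + sip (A x *ᵥ u x) v₁) := by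
  have hAu := fun i => HasWirtinger.sum Finset.univ fun j _ => (hA i j).mul (hu j)
  refine (HasWirtinger.sum Finset.univ fun i _ => (hAu i).mul (hv i).conj).congr ?_ ?_ <;>
  · simp only [sip, mulVec, dotProduct, Finset.sum_add_distrib, add_mul]

theorem HasWirtinger.matrix_mul {A B : E → Matrix (Fin N) (Fin N) ℂ}
    {A₁ A₂ B₁ B₂ : Matrix (Fin N) (Fin N) ℂ}
    (hA : ∀ i j, HasWirtinger (fun y => A y i j) x w (A₁ i j) (A₂ i j))
    (hB : ∀ i j, HasWirtinger (fun y => B y i j) x w (B₁ i j) (B₂ i j)) (i j : Fin N) :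
    HasWirtinger (fun y => (A y * B y) i j) x w
      ((A₁ * B x + A x * B₁) i j) ((A₂ * B x + A x * B₂) i j) := by
  refine (HasWirtinger.sum Finset.univ fun k _ => (hA i k).mul (hB k j)).congr ?_ ?_ <;>
  · simp only [Matrix.add_apply, Matrix.mul_apply, Finset.sum_add_distrib]

theorem DifferentiableAt.matrix_det {A : E → Matrix (Fin N) (Fin N) ℂ}
    (hA : ∀ i j, DifferentiableAt ℝ (fun y => A y i j) x) :
    DifferentiableAt ℝ (fun y => (A y).det) x := by
  simp only [Matrix.det_apply]
  refine DifferentiableAt.fun_sum fun σ _ => DifferentiableAt.fun_const_smul ?_ _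
  exact (HasFDerivAt.finsetProd fun i _ => (hA _ _).hasFDerivAt).differentiableAt

theorem DifferentiableAt.matrix_inv {A : E → Matrix (Fin N) (Fin N) ℂ}
    (hA : ∀ i j, DifferentiableAt ℝ (fun y => A y i j) x) (hdet : (A x).det ≠ 0) (i j : Fin N) :
    DifferentiableAt ℝ (fun y => (A y)⁻¹ i j) x := by
  simp only [Matrix.inv_def, Ring.inverse_eq_inv', Matrix.smul_apply, smul_eq_mul,
    Matrix.adjugate_apply]
  refine ((DifferentiableAt.matrix_det hA).fun_inv hdet).fun_mul
    (DifferentiableAt.matrix_det fun k l => ?_)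
  by_cases hk : k = j
  · simp [Matrix.updateRow_apply, hk]
  · simpa [Matrix.updateRow_apply, hk] using hA k l

end MatrixWirtinger

section Curvature

variable {m N : ℕ}

/-- The entrywise Wirtinger derivative `∂_v h` at `t`. -/
def dirD (h : (Fin m → ℂ) → Matrix (Fin N) (Fin N) ℂ) (v t : Fin m → ℂ) :
    Matrix (Fin N) (Fin N) ℂ :=
  Matrix.of fun i j => wD (fun s => h s i j) t v

/-- The entrywise Wirtinger derivative `∂̄_v h` at `t`. -/
def dirDbar (h : (Fin m → ℂ) → Matrix (Fin N) (Fin N) ℂ) (v t : Fin m → ℂ) :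
    Matrix (Fin N) (Fin N) ℂ :=
  Matrix.of fun i j => wDbar (fun s => h s i j) t v

variable {h : (Fin m → ℂ) → Matrix (Fin N) (Fin N) ℂ} {t : Fin m → ℂ}

theorem dirD_eq_sum (v s : Fin m → ℂ) : dirD h v s = ∑ j, v j • mD h s j := by
  ext i l
  simp [dirD, mD, Matrix.sum_apply, wD_eq_sum _ s v]

theorem mul_sum_curv (hsm : ∀ i j, ContDiffAt ℝ 2 (fun s => h s i j) t)
    (hdet : (h t).det ≠ 0) (v : Fin m → ℂ) :
    h t * ∑ j, ∑ k, (v j * (starRingEnd ℂ) (v k)) • curv h j k t =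
      dirDbar h v t * ((h t)⁻¹ * dirD h v t) - dirD (dirDbar h v) v t := by
  have hd : ∀ i j, DifferentiableAt ℝ (fun s => h s i j) t := fun i j =>
    (hsm i j).differentiableAt (by norm_num)
  have hinv := DifferentiableAt.matrix_inv hd hdet
  have hdirD : ∀ w i l, DifferentiableAt ℝ (fun s => dirD h w s i l) t := fun w i l =>
    differentiableAt_wD (hsm i l) w
  have hmul : ∀ w i l, DifferentiableAt ℝ (fun s => ((h s)⁻¹ * dirD h w s) i l) t :=
    fun w i l => (HasWirtinger.matrix_mul (w := v) (fun i j => (hinv i j).hasWirtinger v)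
      (fun i j => (hdirD w i j).hasWirtinger v) i l).1
  set K := ∑ j, ∑ k, (v j * (starRingEnd ℂ) (v k)) • curv h j k t with hK
  have hM : ∀ i l, HasWirtinger (fun s => ((h s)⁻¹ * dirD h v s) i l) t v
      (wD (fun s => ((h s)⁻¹ * dirD h v s) i l) t v) ((-K) i l) := by
    intro i l
    refine ⟨hmul v i l, rfl, ?_⟩
    have hsum : (fun s => ((h s)⁻¹ * dirD h v s) i l) =
        fun s => ∑ j, v j * ((h s)⁻¹ * mD h s j) i l := by
      funext s
      simp [dirD_eq_sum, Matrix.mul_sum, Matrix.sum_apply]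
    have hj : ∀ j, DifferentiableAt ℝ (fun s => ((h s)⁻¹ * mD h s j) i l) t := fun j =>
      hmul (Pi.single j 1) i l
    rw [hsum, (HasWirtinger.sum Finset.univ fun j _ =>
      (hasWirtinger_const (v j)).mul ((hj j).hasWirtinger v)).2.2]
    simp only [hK, Matrix.neg_apply, Matrix.sum_apply, Matrix.smul_apply, curv, mDbar,
      Matrix.of_apply, smul_eq_mul, wDbar_eq_sum (hj _) v, ← Finset.sum_neg_distrib,
      Finset.mul_sum, zero_mul, zero_add]
    refine Finset.sum_congr rfl fun j _ => Finset.sum_congr rfl fun k _ => ?_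
    ring
  have hprod := fun i l =>
    HasWirtinger.matrix_mul (fun i j => (hd i j).hasWirtinger v) hM i l
  have hev : ∀ᶠ s in nhds t, (h s).det ≠ 0 :=
    (DifferentiableAt.matrix_det hd).continuousAt.eventually_ne hdet
  have heq : dirD (dirDbar h v) v t =
      dirDbar h v t * ((h t)⁻¹ * dirD h v t) + h t * (-K) := by
    ext i l
    have h1 : (fun s => dirD h v s i l) =ᶠ[nhds t]
        fun s => (h s * ((h s)⁻¹ * dirD h v s)) i l := by
      filter_upwards [hev] with s hs
      rw [Matrix.mul_nonsing_inv_cancel_left _ _ (isUnit_iff_ne_zero.2 hs)]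
    have h2 := ((hprod i l).congr_of_eventuallyEq h1).2.2
    exact (wDbar_wD_comm (hsm i l) v).symm.trans h2
  rw [heq, Matrix.mul_neg]
  abel

theorem sum_sip_curv (hsm : ∀ i j, ContDiffAt ℝ 2 (fun s => h s i j) t)
    (hdet : (h t).det ≠ 0) (a : Fin N → ℂ) (v : Fin m → ℂ) :
    ∑ j, ∑ k, sip (h t *ᵥ (curv h j k t *ᵥ a)) a * v j * (starRingEnd ℂ) (v k) =
      sip (dirDbar h v t *ᵥ (((h t)⁻¹ * dirD h v t) *ᵥ a)) a -
        sip (dirD (dirDbar h v) v t *ᵥ a) a := by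
  let L : Matrix (Fin N) (Fin N) ℂ →ₗ[ℂ] ℂ :=
    { toFun := fun A => sip ((h t * A) *ᵥ a) a
      map_add' := fun A B => by rw [Matrix.mul_add, Matrix.add_mulVec, sip_add_left]
      map_smul' := fun c A => by
        rw [Matrix.mul_smul, Matrix.smul_mulVec, sip_smul_left]; rfl }
  have hL : ∀ A, L A = sip ((h t * A) *ᵥ a) a := fun _ => rfl
  have h1 := hL (∑ j, ∑ k, (v j * (starRingEnd ℂ) (v k)) • curv h j k t)
  rw [mul_sum_curv hsm hdet, Matrix.sub_mulVec, sip_sub_left, ← Matrix.mulVec_mulVec] at h1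
  rw [← h1]
  simp only [map_sum, map_smul]
  simp only [hL, smul_eq_mul, Matrix.mulVec_mulVec]
  refine Finset.sum_congr rfl fun j _ => Finset.sum_congr rfl fun k _ => ?_
  ring

end Curvature

section LogNorm

variable {m N : ℕ} {h : (Fin m → ℂ) → Matrix (Fin N) (Fin N) ℂ} {U V : Set (Fin m → ℂ)}
  {u : (Fin m → ℂ) → Fin N → ℂ}

theorem dirDbar_eq_conjTranspose (hU : IsOpen U)
    (hd : ∀ t ∈ U, ∀ i j, DifferentiableAt ℝ (fun s => h s i j) t)
    (hherm : ∀ t ∈ U, (h t).IsHermitian) {t : Fin m → ℂ} (ht : t ∈ U) (w : Fin m → ℂ) :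
    dirDbar h w t = (dirD h w t)ᴴ := by
  ext i j
  have hev : (fun s => h s i j) =ᶠ[nhds t] fun s => (starRingEnd ℂ) (h s j i) := by
    filter_upwards [hU.mem_nhds ht] with s hs
    exact ((hherm s hs).apply i j).symm
  exact (((hd t ht j i).hasWirtinger w).conj.congr_of_eventuallyEq hev).2.2

/-- The complex Hessian of `log ⟪h u, u⟫` for a holomorphic section `u`, expressed through the
curvature and the Chern derivative `e = ∂_w u + h⁻¹ (∂_w h) u`. -/
theorem wD_wDbar_log (hV : IsOpen V)
    (hsm : ∀ i j, ∀ t ∈ V, ContDiffAt ℝ 2 (fun s => h s i j) t)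
    (hpos : ∀ t ∈ V, (h t).PosDef) (hu : DifferentiableOn ℂ u V) (hu0 : ∀ t ∈ V, u t ≠ 0)
    {p : Fin m → ℂ} (hp : p ∈ V) (w : Fin m → ℂ) {e : Fin N → ℂ}
    (he : e = fderiv ℂ u p w + ((h p)⁻¹ * dirD h w p) *ᵥ u p) :
    (sip (h p *ᵥ u p) (u p)) ^ 2 * wD (fun x =>
        wDbar (fun y => ((Real.log (sip (h y *ᵥ u y) (u y)).re : ℝ) : ℂ)) x w) p w =
      sip (h p *ᵥ u p) (u p) *
        -(∑ j, ∑ k, sip (h p *ᵥ (curv h j k p *ᵥ u p)) (u p) * w j * (starRingEnd ℂ) (w k)) +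
      (sip (h p *ᵥ u p) (u p) * sip (h p *ᵥ e) e -
        sip (h p *ᵥ u p) e * sip (h p *ᵥ e) (u p)) := by
  have hd : ∀ t ∈ V, ∀ i j, DifferentiableAt ℝ (fun s => h s i j) t := fun t ht i j =>
    (hsm i j t ht).differentiableAt (by norm_num)
  have hdet : (h p).det ≠ 0 := (Matrix.isUnit_iff_isUnit_det _).1 (hpos p hp).isUnit |>.ne_zero
  set u' : (Fin m → ℂ) → Fin N → ℂ := fun x i => fderiv ℂ (fun y => u y i) x w
  have hui : ∀ i, DifferentiableOn ℂ (fun y => u y i) V := fun i =>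
    (differentiableOn_pi.1 hu) i
  have huW : ∀ x ∈ V, ∀ i, HasWirtinger (fun y => u y i) x w (u' x i) ((0 : Fin N → ℂ) i) :=
    fun x hx i =>
      ((hui i).differentiableAt (hV.mem_nhds hx)).hasFDerivAt.hasWirtinger_of_complex w
  have hu'W : ∀ i, HasWirtinger (fun y => u' y i) p w (wD (fun y => u' y i) p w)
      ((0 : Fin N → ℂ) i) := fun i => by
    have hf := ((differentiableOn_fderiv_apply (hui i) hV w).differentiableAt
      (hV.mem_nhds hp)).hasFDerivAt.hasWirtinger_of_complex w
    exact ⟨hf.1, rfl, hf.2.2⟩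
  have hhW : ∀ x ∈ V, ∀ i j, HasWirtinger (fun y => h y i j) x w (dirD h w x i j)
      (dirDbar h w x i j) := fun x hx i j => (hd x hx i j).hasWirtinger w
  have hhbW : ∀ i j, HasWirtinger (fun y => dirDbar h w y i j) p w
      (dirD (dirDbar h w) w p i j) (dirDbar (dirDbar h w) w p i j) := fun i j =>
    (differentiableAt_wDbar (hsm i j p hp) w).hasWirtinger w
  have hF : ∀ x ∈ V, HasWirtinger (fun y => sip (h y *ᵥ u y) (u y)) x w
      (sip (dirD h w x *ᵥ u x) (u x) + sip (h x *ᵥ u' x) (u x))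
      (sip (dirDbar h w x *ᵥ u x) (u x) + sip (h x *ᵥ u x) (u' x)) := fun x hx =>
    (HasWirtinger.sip_mulVec (hhW x hx) (huW x hx) (huW x hx)).congr
      (by simp [sip]) (by simp [sip])
  have hFpos : ∀ x ∈ V, 0 < sip (h x *ᵥ u x) (u x) := fun x hx =>
    (hpos x hx).sip_pos (hu0 x hx)
  have hlog : ∀ x ∈ V, wDbar (fun y => ((Real.log (sip (h y *ᵥ u y) (u y)).re : ℝ) : ℂ)) x w =
      (sip (h x *ᵥ u x) (u x))⁻¹ *
        (sip (dirDbar h w x *ᵥ u x) (u x) + sip (h x *ᵥ u x) (u' x)) := by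
    intro x hx
    have hev : (fun y => ((Real.log (sip (h y *ᵥ u y) (u y)).re : ℝ) : ℂ)) =ᶠ[nhds x]
        fun y => Complex.log (sip (h y *ᵥ u y) (u y)) := by
      filter_upwards [hV.mem_nhds hx] with y hy
      obtain ⟨hr, hi⟩ := Complex.pos_iff.1 (hFpos y hy)
      rw [Complex.ofReal_log hr.le]
      congr 1
      exact Complex.ext rfl hi
    exact (((hF x hx).comp_hasDerivAt (Complex.hasDerivAt_log
      (Or.inl (Complex.pos_iff.1 (hFpos x hx)).1))).congr_of_eventuallyEq hev).2.2
  have hev : (fun x => wDbar (fun y => ((Real.log (sip (h y *ᵥ u y) (u y)).re : ℝ) : ℂ)) x w)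
      =ᶠ[nhds p] fun x => (sip (h x *ᵥ u x) (u x))⁻¹ *
        (sip (dirDbar h w x *ᵥ u x) (u x) + sip (h x *ᵥ u x) (u' x)) :=
    Filter.eventually_of_mem (hV.mem_nhds hp) hlog
  have hFp := (hFpos p hp).ne'
  have hB := (HasWirtinger.sip_mulVec hhbW (huW p hp) (huW p hp)).add
    (HasWirtinger.sip_mulVec (hhW p hp) (huW p hp) hu'W)
  have hval := ((((hF p hp).comp_hasDerivAt (hasDerivAt_inv hFp)).mul hB).congr_of_eventuallyEq
    hev).2.1
  rw [hval, sum_sip_curv (fun i j => hsm i j p hp) hdet]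
  set b := ((h p)⁻¹ * dirD h w p) *ᵥ u p with hb
  have heq : e = u' p + b := by
    rw [he]
    congr 1
    ext i
    exact congrArg (fun L => L w)
      (hasFDerivAt_pi'.1 (hu.differentiableAt (hV.mem_nhds hp)).hasFDerivAt i).fderiv.symm
  have hD : dirD h w p *ᵥ u p = h p *ᵥ b := by
    rw [hb, Matrix.mulVec_mulVec,
      Matrix.mul_nonsing_inv_cancel_left _ _ (isUnit_iff_ne_zero.2 hdet)]
  have hherm := (hpos p hp).isHermitian
  have hDb : ∀ z, sip (dirDbar h w p *ᵥ z) (u p) = sip (h p *ᵥ z) b := fun z => by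
    rw [dirDbar_eq_conjTranspose hV hd (fun t ht => (hpos t ht).isHermitian) hp,
      sip_conjTranspose_mulVec, hD, ← sip_conjTranspose_mulVec, hherm.eq]
  rw [heq]
  simp only [hDb, hD, Matrix.mulVec_add, sip_add_left, sip_add_right]
  have h0 : ∀ z : Fin N → ℂ, sip z 0 = 0 := fun z => by simp [sip]
  simp only [h0]
  field_simp
  ring

end LogNorm

/-- **Characterization of Griffiths negativity (Section 2):** a hermitian metric on the
trivial bundle is Griffiths-seminegative iff `log⟪h·u, u⟫` is plurisubharmonic for every
nowhere-vanishing holomorphic section `u` over any open `V ⊆ U` (plurisubharmonicity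
expressed as `∂_w∂̄_w ≥ 0` in every direction, via the complex order). -/
theorem stmt9 {m N : ℕ}
    (U : Set (Fin m → ℂ)) (hU : IsOpen U)
    (h : (Fin m → ℂ) → Matrix (Fin N) (Fin N) ℂ)
    (hsm : ∀ a b, ContDiffOn ℝ (⊤ : ℕ∞) (fun t => h t a b) U)
    (hpos : ∀ t ∈ U, (h t).PosDef) :
    (∀ t ∈ U, ∀ a : Fin N → ℂ, ∀ v : Fin m → ℂ,
      (∑ j, ∑ k, sip (h t *ᵥ (curv h j k t *ᵥ a)) a * v j * (starRingEnd ℂ) (v k)) ≤ 0) ↔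
    (∀ V : Set (Fin m → ℂ), V ⊆ U → IsOpen V →
      ∀ u : (Fin m → ℂ) → (Fin N → ℂ), DifferentiableOn ℂ u V →
      (∀ t ∈ V, u t ≠ 0) →
      ∀ p ∈ V, ∀ w : Fin m → ℂ,
        0 ≤ wD (fun x =>
            wDbar (fun y => ((Real.log (sip (h y *ᵥ u y) (u y)).re : ℝ) : ℂ)) x w) p w) := by
  have hsm2 : ∀ i j, ∀ t ∈ U, ContDiffAt ℝ 2 (fun s => h s i j) t := fun i j t ht =>
    ((hsm i j).contDiffAt (hU.mem_nhds ht)).of_le (WithTop.coe_le_coe.2 le_top)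
  constructor
  · intro hG V hVU hV u hu hu0 p hp w
    have hFpos := (hpos p (hVU hp)).sip_pos (hu0 p hp)
    rw [← Complex.mul_nonneg_iff_of_pos (pow_pos hFpos 2),
      wD_wDbar_log hV (fun i j t ht => hsm2 i j t (hVU ht)) (fun t ht => hpos t (hVU ht)) hu hu0
        hp w rfl]
    exact add_nonneg (mul_nonneg hFpos.le (neg_nonneg.2 (hG p (hVU hp) _ w)))
      (sub_nonneg.2 ((hpos p (hVU hp)).sip_mul_sip_le _ _))
  · intro hpsh t ht a v
    rcases eq_or_ne a 0 with rfl | ha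
    · simp [sip]
    rcases eq_or_ne v 0 with rfl | hv
    · simp
    obtain ⟨j, hj⟩ := Function.ne_iff.1 hv
    set b := ((h t)⁻¹ * dirD h v t) *ᵥ a with hb
    set u : (Fin m → ℂ) → Fin N → ℂ := fun x => a - ((x j - t j) / v j) • b with hu
    have hud : Differentiable ℂ u := by
      rw [hu]
      fun_prop
    have hut : u t = a := by simp [hu]
    have huv : fderiv ℂ u t v = -b := by
      have h1 : HasFDerivAt (fun x : Fin m → ℂ => x j)
          (ContinuousLinearMap.proj (R := ℂ) (φ := fun _ : Fin m => ℂ) j) t :=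
        hasFDerivAt_apply j t
      have h2 := (((h1.sub_const (t j)).mul_const (v j)⁻¹).smul_const b).const_sub a
      have h3 : HasFDerivAt u _ t := h2
      rw [h3.fderiv]
      simp [inv_mul_cancel₀ hj]
    set V := U ∩ {x | u x ≠ 0}
    have hV : IsOpen V := hU.inter (isOpen_ne_fun hud.continuous continuous_const)
    have htV : t ∈ V := ⟨ht, by simpa [hut] using ha⟩
    have hnn := hpsh V Set.inter_subset_left hV u hud.differentiableOn (fun x hx => hx.2) t htV v
    have hFpos := (hpos t ht).sip_pos ha
    have hlog := wD_wDbar_log hV (fun i j t ht => hsm2 i j t ht.1) (fun t ht => hpos t ht.1)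
      hud.differentiableOn (fun x hx => hx.2) htV v rfl
    rw [huv, hut, ← hb, neg_add_cancel] at hlog
    have h0 : ∀ z : Fin N → ℂ, sip z 0 = 0 := fun z => by simp [sip]
    rw [h0, h0, mul_zero, zero_mul, sub_zero, add_zero] at hlog
    rw [← neg_nonneg, ← Complex.mul_nonneg_iff_of_pos hFpos, ← hlog]
    exact mul_nonneg (pow_pos hFpos 2).le hnn
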